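/- arXiv:1712.09233 — 3 statements merged into one kernel-verified Lean document; each statement's English description precedes it below -/
import Mathlib

section
/- Fix an integer n ≥ 3 and real parameters l, l̃ each satisfying the admissibility condition 2·sin(π/(2n)) < l < 2·sin(π/n). Then the set of positive solutions (x, x̃) of the n-gonal Siamese system with parameters (l, l̃) is finite. (Geometrically: there exist at most finitely many different n-gonal Siamese dipyramids whose faces are congruent to the isosceles triangles Δ(l) and Δ(l̃).) -/
/-- `(x, x̃) = p` is a positive solution of the `n`-gonal Siamese system with
parameters `(l, l̃)`. -/
def SiamesePosSol (n : ℕ) (l lt : ℝ) (p : ℝ × ℝ) : Prop :=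
  0 < p.1 ∧ p.1 < 1 ∧ 0 < p.2 ∧ p.2 < 1 ∧
  l ≤ 2 * Real.sqrt (1 - p.1 ^ 2) ∧ lt ≤ 2 * Real.sqrt (1 - p.2 ^ 2) ∧
  p.2 = Real.sqrt (1 - p.1 ^ 2) *
      Real.sin (n * Real.arcsin (l / (2 * Real.sqrt (1 - p.1 ^ 2)))) ∧
  p.1 = Real.sqrt (1 - p.2 ^ 2) *
      Real.sin (n * Real.arcsin (lt / (2 * Real.sqrt (1 - p.2 ^ 2))))

open Polynomial in
lemma exists_sinSq_poly (n : ℕ) (hn : 3 ≤ n) :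
    ∃ V : ℝ[X], (∀ θ : ℝ, Real.sin (n * θ) ^ 2 = Real.sin θ ^ 2 * V.eval (Real.sin θ ^ 2)) ∧
      V.eval 0 = (n : ℝ) ^ 2 ∧ V.eval 1 ≠ V.eval 0 := by
  set W : ℝ[X] := C (1/2) * (1 - (Chebyshev.T ℝ n).comp (1 - C 2 * X)) with hW
  have h0 : W.coeff 0 = 0 := by
    rw [coeff_zero_eq_eval_zero, hW]; simp
  have hX : X * W.divX = W := by
    have := X_mul_divX_add W
    rw [h0] at this; simpa using this
  have hev : ∀ θ : ℝ, Real.sin (n * θ) ^ 2 = W.eval (Real.sin θ ^ 2) := by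
    intro θ
    have h1 : (1 - 2 * Real.sin θ ^ 2) = Real.cos (2 * θ) := by
      rw [Real.cos_two_mul, Real.cos_sq']; ring
    have h2 : (Chebyshev.T ℝ n).eval (Real.cos (2 * θ)) = Real.cos (n * (2 * θ)) := by
      simp
    rw [hW]
    simp only [eval_mul, eval_C, eval_sub, eval_one, eval_comp, eval_X]
    rw [h1, h2, show (n : ℝ) * (2 * θ) = 2 * (n * θ) by ring, Real.cos_two_mul, Real.cos_sq']
    ring
  have hV : ∀ θ : ℝ, Real.sin (n * θ) ^ 2 =
      Real.sin θ ^ 2 * W.divX.eval (Real.sin θ ^ 2) := by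
    intro θ
    rw [hev θ]
    conv_lhs => rw [← hX]
    simp
  have hV0 : W.divX.eval 0 = (n : ℝ) ^ 2 := by
    have h1 : W.divX.eval 0 = (derivative W).eval 0 := by
      conv_rhs => rw [← hX]
      simp
    rw [h1, hW]
    have := Chebyshev.T_derivative_eq_U (R := ℝ) n
    simp only [derivative_mul, derivative_comp, derivative_sub, derivative_C, derivative_X,
      derivative_one, this]
    simp [Chebyshev.U_eval_one]
    ring
  refine ⟨W.divX, hV, hV0, ?_⟩
  have h1 := hV (Real.pi / 2)
  simp only [Real.sin_pi_div_two, one_pow, one_mul] at h1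
  have h2 := Real.sin_sq_le_one (n * (Real.pi / 2))
  rw [← h1, hV0]
  have : (3:ℝ) ≤ n := by exact_mod_cast hn
  nlinarith

open Polynomial Filter Topology in
lemma finite_comp (A B : ℝ[X]) (hA : 0 < A.natDegree) (hB : B.eval 0 ≠ 1) :
    {t : ℝ | 0 < t ∧ A.eval t ≠ 1 ∧ 1 - 1 / t = B.eval (1 / (1 - A.eval t))}.Finite := by
  set P : ℝ[X] := (X - 1) * (1 - A) ^ B.natDegree - X * B.reverse.comp (1 - A) with hP
  have key : ∀ t : ℝ, A.eval t ≠ 1 → P.eval t =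
      (1 - A.eval t) ^ B.natDegree * ((t - 1) - t * B.eval (1 / (1 - A.eval t))) := by
    intro t ht
    have hy : 1 - A.eval t ≠ 0 := sub_ne_zero.mpr (Ne.symm ht)
    letI := invertibleOfNonzero (inv_ne_zero hy)
    have h := eval₂_reverse_mul_pow (RingHom.id ℝ) (1 - A.eval t)⁻¹ B
    simp only [invOf_eq_inv, inv_inv, eval₂_id] at h
    rw [hP]
    simp only [eval_sub, eval_mul, eval_pow, eval_one, eval_X, eval_comp]
    rw [one_div, ← h, inv_pow]
    field_simp
  have hP0 : P ≠ 0 := by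
    intro h0
    have hd : 0 < (1 - A).degree := by
      rw [← natDegree_pos_iff_degree_pos]
      have : (1 - A).natDegree = A.natDegree := by
        rw [natDegree_sub_eq_right_of_natDegree_lt]; simpa using hA
      omega
    have ht := Polynomial.abs_tendsto_atTop (1 - A) hd
    have hinv : Tendsto (fun t : ℝ => 1 / (1 - A.eval t)) atTop (𝓝 0) := by
      rw [tendsto_zero_iff_abs_tendsto_zero]
      have := ht.inv_tendsto_atTop
      refine this.congr ?_
      intro t
      simp [abs_inv]
    have h2 : Tendsto (fun t : ℝ => B.eval (1 / (1 - A.eval t))) atTop (𝓝 (B.eval 0)) :=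
      (B.continuous.tendsto 0).comp hinv
    have h3 : Tendsto (fun t : ℝ => 1 - 1 / t) atTop (𝓝 1) := by
      have : Tendsto (fun t : ℝ => 1 - t⁻¹) atTop (𝓝 (1 - 0)) :=
        tendsto_const_nhds.sub tendsto_inv_atTop_zero
      simpa using this
    have h4 : (fun t : ℝ => 1 - 1 / t) =ᶠ[atTop] fun t : ℝ => B.eval (1 / (1 - A.eval t)) := by
      filter_upwards [eventually_gt_atTop 0, ht.eventually_gt_atTop 0] with t h5 h6
      have h7 : 1 - A.eval t ≠ 0 := by
        have := abs_pos.mp h6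
        simpa using this
      have h8 := key t (fun h => h7 (by rw [h]; ring))
      rw [h0, eval_zero] at h8
      have h9 := (mul_eq_zero.mp h8.symm).resolve_left (pow_ne_zero _ h7)
      have h10 : t ≠ 0 := h5.ne'
      have : B.eval (1 / (1 - A.eval t)) = (t - 1) / t := by
        rw [eq_div_iff h10]; linarith
      rw [this]
      field_simp
    exact hB (tendsto_nhds_unique h2 (h3.congr' h4))
  refine (P.rootSet_finite ℝ).subset ?_
  rintro t ⟨h1, h2, h3⟩
  rw [mem_rootSet]
  refine ⟨hP0, ?_⟩
  rw [coe_aeval_eq_eval, key t h2, ← h3]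
  have : t ≠ 0 := h1.ne'
  field_simp
  ring

open Polynomial in
lemma siam_sq (n : ℕ) (V : ℝ[X])
    (hV : ∀ θ : ℝ, Real.sin (n * θ) ^ 2 = Real.sin θ ^ 2 * V.eval (Real.sin θ ^ 2))
    (l x y : ℝ) (hl : 0 < l) (hx0 : 0 < x) (hx1 : x < 1)
    (hle : l ≤ 2 * Real.sqrt (1 - x ^ 2))
    (h : y = Real.sqrt (1 - x ^ 2) *
      Real.sin (n * Real.arcsin (l / (2 * Real.sqrt (1 - x ^ 2))))) :
    y ^ 2 = (C (l ^ 2 / 4) * V.comp (C (l ^ 2 / 4) * X)).eval (1 / (1 - x ^ 2)) := by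
  have hpos : 0 < 1 - x ^ 2 := by nlinarith
  have hr := Real.sqrt_pos.mpr hpos
  have hrr := Real.sq_sqrt hpos.le
  set r := Real.sqrt (1 - x ^ 2)
  have hs : Real.sin (Real.arcsin (l / (2 * r))) = l / (2 * r) := by
    apply Real.sin_arcsin
    · have : 0 < l / (2 * r) := by positivity
      linarith
    · rw [div_le_one (by positivity)]; exact hle
  rw [h, mul_pow, hV, hs]
  simp only [eval_mul, eval_C, eval_comp, eval_X]
  rw [← hrr]
  have e : (l / (2 * r)) ^ 2 = l ^ 2 / 4 * (1 / r ^ 2) := by field_simp; norm_num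
  rw [e]
  field_simp

/-- For admissible parameters there are at most finitely many `n`-gonal
Siamese dipyramids with faces congruent to `Δ(l)` and `Δ(l̃)`. -/
theorem siamese_solutions_finite (n : ℕ) (hn : 3 ≤ n) (l lt : ℝ)
    (hl₁ : 2 * Real.sin (Real.pi / (2 * n)) < l) (hl₂ : l < 2 * Real.sin (Real.pi / n))
    (hlt₁ : 2 * Real.sin (Real.pi / (2 * n)) < lt) (hlt₂ : lt < 2 * Real.sin (Real.pi / n)) :
    {p : ℝ × ℝ | SiamesePosSol n l lt p}.Finite := by
  have hn' : (3:ℝ) ≤ n := by exact_mod_cast hn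
  have hn0 : (0:ℝ) < n := by linarith
  have hsin : 1 / (n:ℝ) < Real.sin (Real.pi / (2 * n)) := by
    have h := Real.mul_lt_sin (x := Real.pi / (2 * n)) (by positivity)
      (by apply div_lt_div_of_pos_left Real.pi_pos <;> linarith)
    have e : 2 / Real.pi * (Real.pi / (2 * n)) = 1 / (n:ℝ) := by
      have := Real.pi_ne_zero
      field_simp
    rwa [e] at h
  have hn1 : 0 < 1 / (n:ℝ) := by positivity
  have hl : 0 < l := by linarith
  have hlt : 0 < lt := by linarith
  have hnlt : 2 < n * lt := by
    have : 2 * (1 / (n:ℝ)) < lt := by linarith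
    have h := mul_lt_mul_of_pos_left this hn0
    have e : (n:ℝ) * (2 * (1 / n)) = 2 := by field_simp
    linarith
  obtain ⟨V, hV, hV0, hV1⟩ := exists_sinSq_poly n hn
  open Polynomial in
  have hfin := finite_comp (C (l ^ 2 / 4) * V.comp (C (l ^ 2 / 4) * X))
    (C (lt ^ 2 / 4) * V.comp (C (lt ^ 2 / 4) * X))
    (by
      rw [Nat.pos_iff_ne_zero]
      intro h
      obtain ⟨c, hc⟩ := natDegree_eq_zero.mp h
      have h0 := congrArg (eval 0) hc
      have h1 := congrArg (eval (4 / l ^ 2)) hc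
      simp only [eval_mul, eval_C, eval_comp, eval_X, mul_zero] at h0 h1
      rw [show l ^ 2 / 4 * (4 / l ^ 2) = 1 by field_simp] at h1
      have h2 : l ^ 2 / 4 ≠ 0 := by positivity
      exact hV1 (mul_left_cancel₀ h2 (h1.symm.trans h0)))
    (by
      simp only [eval_mul, eval_C, eval_comp, eval_X, mul_zero, hV0]
      intro h
      nlinarith)
  refine Set.Finite.of_finite_image (f := fun p : ℝ × ℝ => 1 / (1 - p.1 ^ 2))
    (hfin.subset ?_) ?_
  · rintro _ ⟨⟨x, y⟩, ⟨h1, h2, h3, h4, h5, h6, h7, h8⟩, rfl⟩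
    dsimp only at *
    have hA := siam_sq n V hV l x y hl h1 h2 h5 h7
    have hB := siam_sq n V hV lt y x hlt h3 h4 h6 h8
    have hx : 0 < 1 - x ^ 2 := by nlinarith
    refine ⟨by positivity, ?_, ?_⟩
    · rw [← hA]; nlinarith
    · rw [← hA, ← hB]; simp
  · rintro ⟨x, y⟩ ⟨h1, h2, h3, h4, h5, h6, h7, h8⟩ ⟨x', y'⟩
      ⟨h1', h2', h3', h4', h5', h6', h7', h8'⟩ h
    dsimp only at *
    have hxx : x = x' := by
      rw [one_div, one_div, inv_inj] at h
      have : x ^ 2 = x' ^ 2 := by linarith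
      exact (pow_left_inj₀ h1.le h1'.le two_ne_zero).mp this
    subst hxx
    rw [Prod.mk.injEq]
    exact ⟨rfl, h7.trans h7'.symm⟩
end

section
/- For n = 5, there exists ε > 0 such that for all real l, l̃ with |l − 1| < ε and |l̃ − 1| < ε, the set of positive solutions (x, x̃) of the 5-gonal Siamese system with parameters (l, l̃) has exactly three elements. (Geometrically: there is an open set of parameter pairs giving rise to three-isomeric pentagonal Siamese dipyramids.) -/
/-- `(x, x̃) = p` is a positive solution of the `5`-gonal Siamese system with
parameters `(l, l̃)`. -/
def SiamesePosSol5 (l lt : ℝ) (p : ℝ × ℝ) : Prop :=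
  0 < p.1 ∧ p.1 < 1 ∧ 0 < p.2 ∧ p.2 < 1 ∧
  l ≤ 2 * Real.sqrt (1 - p.1 ^ 2) ∧ lt ≤ 2 * Real.sqrt (1 - p.2 ^ 2) ∧
  p.2 = Real.sqrt (1 - p.1 ^ 2) *
      Real.sin (5 * Real.arcsin (l / (2 * Real.sqrt (1 - p.1 ^ 2)))) ∧
  p.1 = Real.sqrt (1 - p.2 ^ 2) *
      Real.sin (5 * Real.arcsin (lt / (2 * Real.sqrt (1 - p.2 ^ 2))))

/-- Near-one hypothesis on the parameter. -/
def SiamNear (l : ℝ) : Prop := |l - 1| < 1 / 10000000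

noncomputable def siamH (l w : ℝ) : ℝ := (l ^ 5 * w ^ 2 - 5 * l ^ 3 * w + 5 * l) / 2

noncomputable def siamG (l x : ℝ) : ℝ := siamH l (1 / (1 - x ^ 2))

lemma siam_pow {l : ℝ} (h : SiamNear l) :
    (1 - 1 / 10000000 < l ∧ l < 1 + 1 / 10000000) ∧ |l ^ 3 - 1| ≤ 1 / 1000000 ∧
      |l ^ 5 - 1| ≤ 1 / 1000000 := by
  unfold SiamNear at h
  rw [abs_lt] at h
  obtain ⟨h1, h2⟩ := h
  have h1' : (1 - 1 / 10000000 : ℝ) ≤ l := by linarith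
  have h2' : l ≤ (1 + 1 / 10000000 : ℝ) := by linarith
  have h0 : (0 : ℝ) ≤ l := by linarith
  have a3 := pow_le_pow_left₀ (by norm_num) h1' 3
  have b3 := pow_le_pow_left₀ h0 h2' 3
  have a5 := pow_le_pow_left₀ (by norm_num) h1' 5
  have b5 := pow_le_pow_left₀ h0 h2' 5
  norm_num at a3 b3 a5 b5
  refine ⟨⟨by linarith, by linarith⟩, ?_, ?_⟩ <;> rw [abs_le] <;> constructor <;> linarith

lemma siamH_near {l w : ℝ} (h : SiamNear l) (hw1 : 1 ≤ w) (hw2 : w ≤ 5) :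
    |siamH l w - siamH 1 w| ≤ 1 / 10000 := by
  obtain ⟨⟨h1, h2⟩, h3, h5⟩ := siam_pow h
  rw [abs_le] at h3 h5 ⊢
  have e : siamH l w - siamH 1 w =
      ((l ^ 5 - 1) * w ^ 2 - 5 * ((l ^ 3 - 1) * w) + 5 * (l - 1)) / 2 := by
    unfold siamH; ring
  have w2 : w ^ 2 ≤ 25 := by nlinarith
  have w2' : 0 ≤ w ^ 2 := by positivity
  have a1 : (l ^ 5 - 1) * w ^ 2 ≤ 1 / 1000000 * 25 := by nlinarith
  have a2 : -(1 / 1000000 * 25) ≤ (l ^ 5 - 1) * w ^ 2 := by nlinarith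
  have a3 : (l ^ 3 - 1) * w ≤ 1 / 1000000 * 5 := by nlinarith
  have a4 : -(1 / 1000000 * 5) ≤ (l ^ 3 - 1) * w := by nlinarith
  rw [e]
  constructor <;> linarith

lemma siam_w {x b : ℝ} (hx : 0 ≤ x) (hb : x ≤ b) (hb1 : b ≤ 51 / 100) :
    1 ≤ 1 / (1 - x ^ 2) ∧ 1 / (1 - x ^ 2) ≤ 1 / (1 - b ^ 2) ∧ 1 / (1 - b ^ 2) ≤ 3 / 2 := by
  have hbp : b ^ 2 ≤ 2601 / 10000 := by nlinarith
  have hxb : x ^ 2 ≤ b ^ 2 := by nlinarith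
  have hx2 : 0 ≤ x ^ 2 := by positivity
  refine ⟨?_, ?_, ?_⟩
  · rw [le_div_iff₀ (by linarith)]; linarith
  · apply one_div_le_one_div_of_le <;> linarith
  · rw [div_le_iff₀ (by linarith)]; linarith

lemma siamG_one_anti {x b : ℝ} (hx : 0 ≤ x) (hb : x ≤ b) (hb1 : b ≤ 51 / 100) :
    siamG 1 b ≤ siamG 1 x := by
  obtain ⟨h1, h2, h3⟩ := siam_w hx hb hb1
  unfold siamG siamH
  nlinarith

lemma siamG_near {l x : ℝ} (h : SiamNear l) (hx : 0 ≤ x) (hx1 : x ≤ 51 / 100) :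
    |siamG l x - siamG 1 x| ≤ 1 / 10000 := by
  obtain ⟨h1, h2, h3⟩ := siam_w hx le_rfl hx1
  exact siamH_near h h1 (by linarith)

lemma siamG_ge {l x b : ℝ} (h : SiamNear l) (hx : 0 ≤ x) (hb : x ≤ b) (hb1 : b ≤ 51 / 100) :
    siamG 1 b - 1 / 10000 ≤ siamG l x := by
  have h1 := siamG_near h hx (hb.trans hb1)
  have h2 := siamG_one_anti hx hb hb1
  rw [abs_le] at h1
  linarith

lemma siamG_le {l x a : ℝ} (h : SiamNear l) (ha : 0 ≤ a) (hx : a ≤ x) (hb1 : x ≤ 51 / 100) :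
    siamG l x ≤ siamG 1 a + 1 / 10000 := by
  have h1 := siamG_near h (ha.trans hx) hb1
  have h2 := siamG_one_anti ha hx hb1
  rw [abs_le] at h1
  linarith

/-- Algebraic form of the system. -/
def SiamAlg (l lt x y : ℝ) : Prop :=
  0 ≤ x ∧ x ≤ 51 / 100 ∧ 0 ≤ y ∧ y ≤ 51 / 100 ∧ y = siamG l x ∧ x = siamG lt y

lemma SiamAlg.swap {l lt x y : ℝ} (h : SiamAlg l lt x y) : SiamAlg lt l y x := by
  obtain ⟨a, b, c, d, e, f⟩ := h
  exact ⟨c, d, a, b, f, e⟩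

lemma siam_sin5 (t : ℝ) :
    Real.sin (5 * t) = 16 * Real.sin t ^ 5 - 20 * Real.sin t ^ 3 + 5 * Real.sin t := by
  have e : 5 * t = 3 * t + 2 * t := by ring
  have hc : Real.cos t ^ 2 = 1 - Real.sin t ^ 2 := by
    have := Real.sin_sq_add_cos_sq t; linarith
  rw [e, Real.sin_add, Real.sin_three_mul, Real.cos_three_mul, Real.sin_two_mul,
    Real.cos_two_mul]
  have e2 : (3 * Real.sin t - 4 * Real.sin t ^ 3) * (2 * Real.cos t ^ 2 - 1) +
      (4 * Real.cos t ^ 3 - 3 * Real.cos t) * (2 * Real.sin t * Real.cos t) =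
      (3 * Real.sin t - 4 * Real.sin t ^ 3) * (2 * Real.cos t ^ 2 - 1) +
      (4 * (Real.cos t ^ 2) ^ 2 - 3 * Real.cos t ^ 2) * (2 * Real.sin t) := by ring
  rw [e2, hc]
  ring

lemma siam_formula {l x : ℝ} (hl : 0 < l) (hx : x ^ 2 < 1)
    (h : l ≤ 2 * Real.sqrt (1 - x ^ 2)) :
    Real.sqrt (1 - x ^ 2) * Real.sin (5 * Real.arcsin (l / (2 * Real.sqrt (1 - x ^ 2)))) =
      siamG l x := by
  have hu : 0 < 1 - x ^ 2 := by linarith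
  have hR : 0 < Real.sqrt (1 - x ^ 2) := Real.sqrt_pos.mpr hu
  have hR2 : Real.sqrt (1 - x ^ 2) ^ 2 = 1 - x ^ 2 := Real.sq_sqrt hu.le
  unfold siamG siamH
  rw [← hR2]
  simp only [Real.sqrt_sq hR.le]
  generalize Real.sqrt (1 - x ^ 2) = R at *
  rw [siam_sin5, Real.sin_arcsin]
  · field_simp
    ring
  · have : 0 ≤ l / (2 * R) := by positivity
    linarith
  · rw [div_le_one (by positivity)]; exact h

lemma siam_bound {l x : ℝ} (hn : SiamNear l) (hx : x ^ 2 < 1)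
    (h : l ≤ 2 * Real.sqrt (1 - x ^ 2)) : siamG l x ≤ 51 / 100 := by
  obtain ⟨⟨h1, h2⟩, -, -⟩ := siam_pow hn
  have hu : 0 < 1 - x ^ 2 := by linarith
  have hR2 : Real.sqrt (1 - x ^ 2) ^ 2 = 1 - x ^ 2 := Real.sq_sqrt hu.le
  have h4 : l ^ 2 ≤ 4 * (1 - x ^ 2) := by nlinarith
  have h5 : (999999 / 1000000 : ℝ) ≤ l ^ 2 := by nlinarith
  have hw1 : 1 ≤ 1 / (1 - x ^ 2) := by
    rw [le_div_iff₀ hu]; nlinarith [sq_nonneg x]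
  have hw2 : 1 / (1 - x ^ 2) ≤ 4001 / 1000 := by
    rw [div_le_iff₀ hu]; linarith
  have h6 := siamH_near hn hw1 (by linarith)
  rw [abs_le] at h6
  have h7 : siamH 1 (1 / (1 - x ^ 2)) ≤ 505 / 1000 := by
    unfold siamH
    nlinarith
  unfold siamG
  linarith

lemma siam_to_alg {l lt : ℝ} (hl : SiamNear l) (hlt : SiamNear lt) {p : ℝ × ℝ}
    (h : SiamesePosSol5 l lt p) : SiamAlg l lt p.1 p.2 := by
  obtain ⟨a, b, c, d, e, f, g, i⟩ := h
  have hl0 : 0 < l := by linarith [(siam_pow hl).1.1]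
  have hlt0 : 0 < lt := by linarith [(siam_pow hlt).1.1]
  have p1 : p.1 ^ 2 < 1 := by nlinarith
  have p2 : p.2 ^ 2 < 1 := by nlinarith
  rw [siam_formula hl0 p1 e] at g
  rw [siam_formula hlt0 p2 f] at i
  have b1 := siam_bound hl p1 e
  have b2 := siam_bound hlt p2 f
  exact ⟨a.le, by linarith, c.le, by linarith, g, i⟩

lemma siam_pos {l x : ℝ} (hn : SiamNear l) (h0 : 0 ≤ x) (hx : x ≤ 51 / 100) :
    0 < siamG l x := by
  have := siamG_ge hn h0 hx le_rfl
  have e : (0 : ℝ) < siamG 1 (51 / 100) - 1 / 10000 := by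
    unfold siamG siamH; norm_num
  linarith

lemma siam_sqrt {l x : ℝ} (hn : SiamNear l) (h0 : 0 ≤ x) (hx : x ≤ 51 / 100) :
    l ≤ 2 * Real.sqrt (1 - x ^ 2) := by
  have h2 := (siam_pow hn).1.2
  have : (8 / 10 : ℝ) ≤ Real.sqrt (1 - x ^ 2) := by
    apply Real.le_sqrt_of_sq_le
    nlinarith
  linarith

lemma siam_of_alg {l lt x y : ℝ} (hl : SiamNear l) (hlt : SiamNear lt)
    (h : SiamAlg l lt x y) : SiamesePosSol5 l lt (x, y) := by
  obtain ⟨a, b, c, d, e, f⟩ := h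
  have hl0 : 0 < l := by linarith [(siam_pow hl).1.1]
  have hlt0 : 0 < lt := by linarith [(siam_pow hlt).1.1]
  have p1 : x ^ 2 < 1 := by nlinarith
  have p2 : y ^ 2 < 1 := by nlinarith
  have s1 := siam_sqrt hl a b
  have s2 := siam_sqrt hlt c d
  have q1 := siam_pos hl a b
  have q2 := siam_pos hlt c d
  rw [← e] at q1
  rw [← f] at q2
  refine ⟨q2, by simp only; linarith, q1, by simp only; linarith, s1, s2, ?_, ?_⟩
  · simp only
    rw [siam_formula hl0 p1 s1]; exact e
  · simp only
    rw [siam_formula hlt0 p2 s2]; exact f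

/-- Divided difference of `siamG`. -/
noncomputable def siamM (l x z : ℝ) : ℝ :=
  (x + z) * ((1 / (1 - x ^ 2)) * (1 / (1 - z ^ 2)) *
    (5 * l ^ 3 - l ^ 5 * (1 / (1 - x ^ 2) + 1 / (1 - z ^ 2)))) / 2

lemma siam_slope {l x z : ℝ} (hx0 : 0 ≤ x) (hx : x ≤ 51 / 100) (hz0 : 0 ≤ z)
    (hz : z ≤ 51 / 100) : siamG l x - siamG l z = -(x - z) * siamM l x z := by
  have h1 : 1 - x ^ 2 ≠ 0 := by nlinarith
  have h2 : 1 - z ^ 2 ≠ 0 := by nlinarith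
  unfold siamG siamH siamM
  field_simp
  ring

lemma siam_N_mono {a b c d : ℝ} (ha : 1 ≤ a) (hac : a ≤ c) (hc : c ≤ 3 / 2)
    (hb : 1 ≤ b) (hbd : b ≤ d) (hd : d ≤ 3 / 2) :
    a * b * (5 - (a + b)) ≤ c * d * (5 - (c + d)) := by
  have e1 : c * b * (5 - (c + b)) - a * b * (5 - (a + b)) = b * ((c - a) * (5 - c - a - b)) := by
    ring
  have e2 : c * d * (5 - (c + d)) - c * b * (5 - (c + b)) = c * ((d - b) * (5 - d - b - c)) := by
    ring
  have p1 : 0 ≤ b * ((c - a) * (5 - c - a - b)) :=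
    mul_nonneg (by linarith) (mul_nonneg (by linarith) (by linarith))
  have p2 : 0 ≤ c * ((d - b) * (5 - d - b - c)) :=
    mul_nonneg (by linarith) (mul_nonneg (by linarith) (by linarith))
  linarith

lemma siam_N_near {l a b : ℝ} (h : SiamNear l) (ha : 1 ≤ a) (ha2 : a ≤ 3 / 2)
    (hb : 1 ≤ b) (hb2 : b ≤ 3 / 2) :
    |a * b * (5 * l ^ 3 - l ^ 5 * (a + b)) - a * b * (5 - (a + b))| ≤ 1 / 10000 := by
  obtain ⟨-, h3, h5⟩ := siam_pow h
  have e : a * b * (5 * l ^ 3 - l ^ 5 * (a + b)) - a * b * (5 - (a + b)) =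
    (a * b) * (5 * (l ^ 3 - 1) - (l ^ 5 - 1) * (a + b)) := by ring
  rw [e, abs_mul]
  have q1 : |a * b| ≤ 9 / 4 := by
    rw [abs_of_nonneg (by positivity)]; nlinarith
  have q2 : |5 * (l ^ 3 - 1) - (l ^ 5 - 1) * (a + b)| ≤ 1 / 100000 := by
    rw [abs_le] at h3 h5 ⊢
    constructor <;> nlinarith
  calc _ ≤ (9 / 4 : ℝ) * (1 / 100000) := mul_le_mul q1 q2 (abs_nonneg _) (by norm_num)
    _ ≤ _ := by norm_num

lemma siamM_le {l x z b B : ℝ} (h : SiamNear l) (hx0 : 0 ≤ x) (hx : x ≤ b) (hz0 : 0 ≤ z)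
    (hz : z ≤ b) (hb : b ≤ 51 / 100)
    (hB : b * ((1 / (1 - b ^ 2)) ^ 2 * (5 - 2 * (1 / (1 - b ^ 2))) + 1 / 10000) ≤ B) :
    siamM l x z ≤ B ∧ 0 ≤ siamM l x z := by
  obtain ⟨a1, a2, a3⟩ := siam_w hx0 hx hb
  obtain ⟨b1, b2, -⟩ := siam_w hz0 hz hb
  unfold siamM
  have n := siam_N_near h a1 (a2.trans a3) b1 (b2.trans a3)
  have m := siam_N_mono a1 a2 a3 b1 b2 a3
  have k := siam_N_mono le_rfl a1 (a2.trans a3) le_rfl b1 (b2.trans a3)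
  generalize 1 / (1 - x ^ 2) = u at *
  generalize 1 / (1 - z ^ 2) = v at *
  generalize 1 / (1 - b ^ 2) = w at *
  rw [abs_le] at n
  generalize u * v * (5 * l ^ 3 - l ^ 5 * (u + v)) = T at *
  have T0 : 0 ≤ T := by norm_num at k; linarith
  have T1 : T ≤ w ^ 2 * (5 - 2 * w) + 1 / 10000 := by nlinarith
  constructor
  · refine le_trans ?_ hB
    have : (x + z) * T ≤ (2 * b) * (w ^ 2 * (5 - 2 * w) + 1 / 10000) :=
      mul_le_mul (by linarith) T1 T0 (by linarith)
    linarith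
  · positivity

lemma siamM_ge {l x z : ℝ} (h : SiamNear l) (hx : 3 / 10 ≤ x) (hx1 : x ≤ 51 / 100)
    (hz : 3 / 10 ≤ z) (hz1 : z ≤ 51 / 100) : 101 / 100 ≤ siamM l x z := by
  obtain ⟨a1, a2, a3⟩ := siam_w (by norm_num) hx hx1
  obtain ⟨b1, b2, b3⟩ := siam_w (by norm_num) hz hz1
  unfold siamM
  have n := siam_N_near h (a1.trans a2) a3 (b1.trans b2) b3
  have m := siam_N_mono a1 a2 a3 b1 b2 b3
  generalize 1 / (1 - x ^ 2) = u at *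
  generalize 1 / (1 - z ^ 2) = v at *
  rw [abs_le] at n
  generalize u * v * (5 * l ^ 3 - l ^ 5 * (u + v)) = T at *
  norm_num at m
  have T1 : 338 / 100 ≤ T := by linarith
  nlinarith

lemma siam_uniq_core {l lt x y x' y' : ℝ} (h : SiamAlg l lt x y) (h' : SiamAlg l lt x' y')
    (hM : siamM l x x' * siamM lt y y' ≠ 1) : (x, y) = (x', y') := by
  obtain ⟨a, b, c, d, e, f⟩ := h
  obtain ⟨a', b', c', d', e', f'⟩ := h'
  have s1 := siam_slope (l := l) a b a' b'
  have s2 := siam_slope (l := lt) c d c' d'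
  rw [← e, ← e'] at s1
  rw [← f, ← f'] at s2
  have : (x - x') * (siamM l x x' * siamM lt y y' - 1) = 0 := by
    rw [s1] at s2
    linear_combination -s2
  rcases mul_eq_zero.mp this with h | h
  · have hx : x = x' := by linarith
    rw [h] at s1
    have hy : y = y' := by linarith
    rw [hx, hy]
  · exact absurd (by linarith) hM

lemma siam_half {l lt x y : ℝ} (hl : SiamNear l) (h : SiamAlg l lt x y) :
    y ≤ 501 / 1000 := by
  obtain ⟨a, b, c, d, e, f⟩ := h
  have := siamG_le hl le_rfl a b
  have e2 : siamG 1 0 = 1 / 2 := by unfold siamG siamH; norm_num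
  linarith

lemma siam_uniq_left {l lt x y x' y' : ℝ} (hl : SiamNear l) (hlt : SiamNear lt)
    (h : SiamAlg l lt x y) (h' : SiamAlg l lt x' y')
    (hx : x ≤ 14 / 100) (hx' : x' ≤ 14 / 100) : (x, y) = (x', y') := by
  apply siam_uniq_core h h'
  obtain ⟨p1, p2⟩ := siamM_le (B := 45 / 100) hl h.1 hx h'.1 hx' (by norm_num) (by norm_num)
  obtain ⟨q1, q2⟩ := siamM_le (B := 21 / 10) hlt h.2.2.1 (siam_half hl h) h'.2.2.1
    (siam_half hl h') (by norm_num) (by norm_num)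
  have := mul_le_mul p1 q1 q2 (by norm_num)
  intro hh
  rw [hh] at this
  norm_num at this

lemma siam_uniq_mid {l lt x y x' y' : ℝ} (hl : SiamNear l) (hlt : SiamNear lt)
    (h : SiamAlg l lt x y) (h' : SiamAlg l lt x' y')
    (hx : 3 / 10 ≤ x) (hx' : 3 / 10 ≤ x') (hy : 3 / 10 ≤ y) (hy' : 3 / 10 ≤ y') :
    (x, y) = (x', y') := by
  apply siam_uniq_core h h'
  have p := siamM_ge hl hx h.2.1 hx' h'.2.1
  have q := siamM_ge hlt hy h.2.2.2.1 hy' h'.2.2.2.1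
  intro hh
  nlinarith

lemma siam_step {l lt x y : ℝ} (hl : SiamNear l) (hlt : SiamNear lt)
    (h : SiamAlg l lt x y) (b c a : ℝ) (hxb : x ≤ b) (hb : b ≤ 51 / 100) (hc0 : 0 ≤ c)
    (hc : c ≤ siamG 1 b - 1 / 10000) (ha : siamG 1 c + 1 / 10000 ≤ a) : x ≤ a := by
  obtain ⟨p, q, r, s, e, f⟩ := h
  have h1 := siamG_ge hl p hxb hb
  have h2 := siamG_le hlt hc0 (x := y) (by linarith) s
  linarith

lemma siam_gap {l lt x y : ℝ} (hl : SiamNear l) (hlt : SiamNear lt)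
    (h : SiamAlg l lt x y) (hx : x ≤ 3 / 10) : x ≤ 14 / 100 := by
  replace hx := siam_step hl hlt h (3 / 10) (3564 / 10000) (2925 / 10000) hx (by norm_num) (by norm_num)
    (by unfold siamG siamH; norm_num) (by unfold siamG siamH; norm_num)
  replace hx := siam_step hl hlt h (2925 / 10000) (3639 / 10000) (2829 / 10000) hx (by norm_num) (by norm_num)
    (by unfold siamG siamH; norm_num) (by unfold siamG siamH; norm_num)
  replace hx := siam_step hl hlt h (2829 / 10000) (3731 / 10000) (2707 / 10000) hx (by norm_num) (by norm_num)
    (by unfold siamG siamH; norm_num) (by unfold siamG siamH; norm_num)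
  replace hx := siam_step hl hlt h (2707 / 10000) (3844 / 10000) (2551 / 10000) hx (by norm_num) (by norm_num)
    (by unfold siamG siamH; norm_num) (by unfold siamG siamH; norm_num)
  replace hx := siam_step hl hlt h (2551 / 10000) (3979 / 10000) (2357 / 10000) hx (by norm_num) (by norm_num)
    (by unfold siamG siamH; norm_num) (by unfold siamG siamH; norm_num)
  replace hx := siam_step hl hlt h (2357 / 10000) (4133 / 10000) (2124 / 10000) hx (by norm_num) (by norm_num)
    (by unfold siamG siamH; norm_num) (by unfold siamG siamH; norm_num)
  replace hx := siam_step hl hlt h (2124 / 10000) (4301 / 10000) (1855 / 10000) hx (by norm_num) (by norm_num)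
    (by unfold siamG siamH; norm_num) (by unfold siamG siamH; norm_num)
  replace hx := siam_step hl hlt h (1855 / 10000) (4470 / 10000) (1568 / 10000) hx (by norm_num) (by norm_num)
    (by unfold siamG siamH; norm_num) (by unfold siamG siamH; norm_num)
  replace hx := siam_step hl hlt h (1568 / 10000) (4623 / 10000) (14 / 100) hx (by norm_num) (by norm_num)
    (by unfold siamG siamH; norm_num) (by unfold siamG siamH; norm_num)
  exact hx

lemma siam_exists {l lt a b : ℝ} (hl : SiamNear l) (hlt : SiamNear lt) (ha0 : 0 ≤ a)
    (hab : a ≤ b) (hb : b ≤ 36 / 100)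
    (h : (a ≤ siamG lt (siamG l a) ∧ siamG lt (siamG l b) ≤ b) ∨
      (siamG lt (siamG l a) ≤ a ∧ b ≤ siamG lt (siamG l b))) :
    ∃ x y, SiamAlg l lt x y ∧ a ≤ x ∧ x ≤ b := by
  have bd : ∀ x ∈ Set.Icc a b, 0 ≤ siamG l x ∧ siamG l x ≤ 51 / 100 := by
    intro x hx
    have x0 : 0 ≤ x := ha0.trans hx.1
    have x1 : x ≤ 51 / 100 := by linarith [hx.2]
    refine ⟨(siam_pos hl x0 x1).le, ?_⟩
    have := siamG_le hl le_rfl x0 x1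
    have e2 : siamG 1 0 = 1 / 2 := by unfold siamG siamH; norm_num
    linarith
  have cont : ∀ k : ℝ, ContinuousOn (siamG k) (Set.Icc 0 (51 / 100)) := by
    intro k
    unfold siamG siamH
    have hw : ContinuousOn (fun x : ℝ => 1 / (1 - x ^ 2)) (Set.Icc 0 (51 / 100)) := by
      apply ContinuousOn.div (by fun_prop) (by fun_prop)
      intro x hx
      nlinarith [hx.1, hx.2]
    fun_prop
  have c1 : ContinuousOn (siamG l) (Set.Icc a b) :=
    (cont l).mono (Set.Icc_subset_Icc ha0 (by linarith))
  have c2 : ContinuousOn (fun x => siamG lt (siamG l x)) (Set.Icc a b) :=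
    (cont lt).comp c1 (fun x hx => bd x hx)
  have c3 : ContinuousOn (fun x => siamG lt (siamG l x) - x) (Set.Icc a b) :=
    c2.sub continuousOn_id
  have : ∃ x ∈ Set.Icc a b, siamG lt (siamG l x) - x = 0 := by
    rcases h with ⟨h1, h2⟩ | ⟨h1, h2⟩
    · obtain ⟨x, hx, hx2⟩ := intermediate_value_Icc' hab c3
        (show (0 : ℝ) ∈ Set.Icc _ _ from ⟨by linarith, by linarith⟩)
      exact ⟨x, hx, hx2⟩
    · obtain ⟨x, hx, hx2⟩ := intermediate_value_Icc hab c3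
        (show (0 : ℝ) ∈ Set.Icc _ _ from ⟨by linarith, by linarith⟩)
      exact ⟨x, hx, hx2⟩
  obtain ⟨x, hx, hx2⟩ := this
  obtain ⟨y0, y1⟩ := bd x hx
  exact ⟨x, siamG l x, ⟨ha0.trans hx.1, by linarith [hx.2], y0, y1, rfl, by linarith⟩, hx.1, hx.2⟩

lemma siamGG_ge {l lt x c a : ℝ} (hl : SiamNear l) (hlt : SiamNear lt) (hx0 : 0 ≤ x)
    (hx : x ≤ 51 / 100) (hc : siamG 1 x + 1 / 10000 ≤ c) (hc1 : c ≤ 51 / 100)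
    (ha : a ≤ siamG 1 c - 1 / 10000) : a ≤ siamG lt (siamG l x) := by
  have h1 := siamG_le hl hx0 le_rfl hx
  have h0 := siam_pos hl hx0 hx
  have h2 := siamG_ge hlt h0.le (h1.trans hc) hc1
  linarith

lemma siamGG_le {l lt x c a : ℝ} (hl : SiamNear l) (hlt : SiamNear lt) (hx0 : 0 ≤ x)
    (hx : x ≤ 51 / 100) (hc : c ≤ siamG 1 x - 1 / 10000) (hc1 : 0 ≤ c)
    (ha : siamG 1 c + 1 / 10000 ≤ a) : siamG lt (siamG l x) ≤ a := by
  have h1 := siamG_ge hl hx0 le_rfl hx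
  have h0 := siamG_le hl le_rfl hx0 hx
  have e2 : siamG 1 0 = 1 / 2 := by unfold siamG siamH; norm_num
  have h2 := siamG_le hlt hc1 (hc.trans h1) (by linarith)
  linarith

lemma siam_exists_left {l lt : ℝ} (hl : SiamNear l) (hlt : SiamNear lt) :
    ∃ x y, SiamAlg l lt x y ∧ x ≤ 14 / 100 ∧ 3 / 10 < y := by
  obtain ⟨x, y, h, h0, h1⟩ := siam_exists (a := 0) (b := 14 / 100) hl hlt le_rfl (by norm_num)
    (by norm_num) (Or.inl
      ⟨siamGG_ge (c := 501 / 1000) hl hlt le_rfl (by norm_num)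
        (by unfold siamG siamH; norm_num) (by norm_num) (by unfold siamG siamH; norm_num),
       siamGG_le (c := 47 / 100) hl hlt (by norm_num) (by norm_num)
        (by unfold siamG siamH; norm_num) (by norm_num) (by unfold siamG siamH; norm_num)⟩)
  refine ⟨x, y, h, h1, ?_⟩
  have := siamG_ge hl h0 h1 (by norm_num)
  rw [h.2.2.2.2.1]
  refine lt_of_lt_of_le ?_ this
  unfold siamG siamH; norm_num

lemma siam_exists_mid {l lt : ℝ} (hl : SiamNear l) (hlt : SiamNear lt) :
    ∃ x y, SiamAlg l lt x y ∧ 3 / 10 ≤ x ∧ 3 / 10 ≤ y := by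
  obtain ⟨x, y, h, h0, h1⟩ := siam_exists (a := 3 / 10) (b := 34 / 100) hl hlt (by norm_num)
    (by norm_num) (by norm_num) (Or.inr
      ⟨siamGG_le (c := 356 / 1000) hl hlt (by norm_num) (by norm_num)
        (by unfold siamG siamH; norm_num) (by norm_num) (by unfold siamG siamH; norm_num),
       siamGG_ge (c := 313 / 1000) hl hlt (by norm_num) (by norm_num)
        (by unfold siamG siamH; norm_num) (by norm_num) (by unfold siamG siamH; norm_num)⟩)
  refine ⟨x, y, h, h0, ?_⟩
  have := siamG_ge hl h.1 h1 (by norm_num)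
  rw [h.2.2.2.2.1]
  refine le_trans ?_ this
  unfold siamG siamH; norm_num

/-- Near `(l, l̃) = (1, 1)` there is an open set of parameter pairs giving
exactly three isomeric pentagonal Siamese dipyramids. -/
theorem siamese_three_isomeric_open :
    ∃ ε > (0:ℝ), ∀ l lt : ℝ, |l - 1| < ε → |lt - 1| < ε →
      {p : ℝ × ℝ | SiamesePosSol5 l lt p}.encard = 3 := by
  refine ⟨1 / 10000000, by norm_num, fun l lt hl hlt => ?_⟩
  change SiamNear l at hl
  change SiamNear lt at hlt
  obtain ⟨x1, y1, s1, a1, b1⟩ := siam_exists_left hl hlt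
  obtain ⟨x2, y2, s2, a2, b2⟩ := siam_exists_mid hl hlt
  obtain ⟨y3, x3, s3, a3, b3⟩ := siam_exists_left hlt hl
  rw [Set.encard_eq_three]
  refine ⟨(x1, y1), (x2, y2), (x3, y3), ?_, ?_, ?_, ?_⟩
  · intro h
    simp only [Prod.mk.injEq] at h
    linarith [h.1]
  · intro h
    simp only [Prod.mk.injEq] at h
    linarith [h.1]
  · intro h
    simp only [Prod.mk.injEq] at h
    linarith [h.2]
  · ext ⟨x, y⟩
    simp only [Set.mem_ofPred_eq, Set.mem_insert_iff, Set.mem_singleton_iff]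
    constructor
    · intro h
      have s : SiamAlg l lt x y := siam_to_alg hl hlt h
      by_cases hx : x ≤ 3 / 10
      · left
        exact siam_uniq_left hl hlt s s1 (siam_gap hl hlt s hx) a1
      · by_cases hy : y ≤ 3 / 10
        · right; right
          have := siam_uniq_left hlt hl s.swap s3 (siam_gap hlt hl s.swap hy) a3
          simp only [Prod.mk.injEq] at this ⊢
          exact this.symm
        · right; left
          push Not at hx hy
          exact siam_uniq_mid hl hlt s s2 hx.le a2 hy.le b2
    · rintro (h | h | h) <;> rw [h]
      · exact siam_of_alg hl hlt s1
      · exact siam_of_alg hl hlt s2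
      · exact siam_of_alg hl hlt s3.swap
end

section
/- For n = 5, there exists a nonempty open set W ⊆ ℝ² such that for every (l, l̃) ∈ W, both l and l̃ satisfy 2·sin(π/10) < l, l̃ < 2·sin(π/5), and the set of positive solutions (x, x̃) of the 5-gonal Siamese system with parameters (l, l̃) has exactly two elements. (Geometrically: there is an open set of parameter pairs giving rise to two-isomeric pentagonal Siamese dipyramids.) -/
/-- The algebraic form of the map: `sf l x = √(1-x²) sin (5 arcsin (l / (2√(1-x²))))`. -/
noncomputable def sf (l x : ℝ) : ℝ :=
  (5 * l - 5 * l ^ 3 * (1 / (1 - x ^ 2)) + l ^ 5 * (1 / (1 - x ^ 2)) ^ 2) / 2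

lemma sin_five_mul_aux (θ : ℝ) :
    Real.sin (5 * θ) = 16 * Real.sin θ ^ 5 - 20 * Real.sin θ ^ 3 + 5 * Real.sin θ := by
  have h : 5 * θ = 2 * θ + 3 * θ := by ring
  rw [h, Real.sin_add, Real.sin_two_mul, Real.cos_two_mul, Real.sin_three_mul,
    Real.cos_three_mul]
  have hc : Real.cos θ ^ 2 = 1 - Real.sin θ ^ 2 := Real.cos_sq' θ
  have hc4 : Real.cos θ ^ 4 = (1 - Real.sin θ ^ 2) ^ 2 := by rw [← hc]; ring
  have e : 2 * Real.sin θ * Real.cos θ * (4 * Real.cos θ ^ 3 - 3 * Real.cos θ)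
      + (2 * Real.cos θ ^ 2 - 1) * (3 * Real.sin θ - 4 * Real.sin θ ^ 3)
      = 2 * Real.sin θ * (4 * Real.cos θ ^ 4 - 3 * Real.cos θ ^ 2)
      + (2 * Real.cos θ ^ 2 - 1) * (3 * Real.sin θ - 4 * Real.sin θ ^ 3) := by ring
  rw [e, hc4, hc]; ring

lemma sqrt_cond (l x : ℝ) (hl : 0 < l) (hx0 : 0 < x) (hx : x < 1) :
    l ≤ 2 * Real.sqrt (1 - x ^ 2) ↔ l ^ 2 ≤ 4 * (1 - x ^ 2) := by
  have hu : 0 < 1 - x ^ 2 := by nlinarith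
  have hs := Real.sqrt_nonneg (1 - x ^ 2)
  have hq := Real.sq_sqrt hu.le
  constructor
  · intro h; nlinarith
  · intro h; nlinarith

lemma sf_eq (l x : ℝ) (hl : 0 < l) (hx0 : 0 < x) (hx : x < 1) (h : l ^ 2 ≤ 4 * (1 - x ^ 2)) :
    Real.sqrt (1 - x ^ 2) * Real.sin (5 * Real.arcsin (l / (2 * Real.sqrt (1 - x ^ 2))))
      = sf l x := by
  have hroot := (sqrt_cond l x hl hx0 hx).2 h
  have hu : 0 < 1 - x ^ 2 := by nlinarith
  have hs := Real.sqrt_pos.2 hu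
  have hq := Real.sq_sqrt hu.le
  rw [sin_five_mul_aux, Real.sin_arcsin]
  · unfold sf
    rw [← hq]
    set r := Real.sqrt (1 - x ^ 2)
    rw [Real.sqrt_sq hs.le]
    field_simp
    ring
  · have : 0 ≤ l / (2 * Real.sqrt (1 - x ^ 2)) := by positivity
    linarith
  · rw [div_le_one (by positivity)]; exact hroot

/-- Algebraic form of the system. -/
def Sys (l m x y : ℝ) : Prop :=
  0 < x ∧ x < 1 ∧ 0 < y ∧ y < 1 ∧ l ^ 2 ≤ 4 * (1 - x ^ 2) ∧ m ^ 2 ≤ 4 * (1 - y ^ 2) ∧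
    y = sf l x ∧ x = sf m y

lemma sol_iff (l m : ℝ) (hl : 0 < l) (hm : 0 < m) (p : ℝ × ℝ) :
    SiamesePosSol5 l m p ↔ Sys l m p.1 p.2 := by
  unfold SiamesePosSol5 Sys
  constructor
  · rintro ⟨a, b, c, d, e, f, g, h⟩
    have e' := (sqrt_cond _ _ hl a b).1 e
    have f' := (sqrt_cond _ _ hm c d).1 f
    rw [sf_eq _ _ hl a b e'] at g
    rw [sf_eq _ _ hm c d f'] at h
    exact ⟨a, b, c, d, e', f', g, h⟩
  · rintro ⟨a, b, c, d, e', f', g, h⟩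
    refine ⟨a, b, c, d, (sqrt_cond _ _ hl a b).2 e', (sqrt_cond _ _ hm c d).2 f', ?_, ?_⟩
    · rw [sf_eq _ _ hl a b e']; exact g
    · rw [sf_eq _ _ hm c d f']; exact h

/-- The divided difference of `sf`. -/
lemma sf_diff (l x z : ℝ) (hx : 1 - x ^ 2 ≠ 0) (hz : 1 - z ^ 2 ≠ 0) :
    sf l x - sf l z = (z - x) * ((1 / (1 - x ^ 2)) * (1 / (1 - z ^ 2)) * (x + z) *
      (5 * l ^ 3 - l ^ 5 * (1 / (1 - x ^ 2) + 1 / (1 - z ^ 2))) / 2) := by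
  unfold sf; field_simp; ring

lemma sf_anti (l x z : ℝ) (hl : 0 < l) (hx : 0 ≤ x) (hxz : x ≤ z) (hz : z < 1)
    (h : l ^ 2 ≤ 5 / 2 * (1 - z ^ 2)) : sf l z ≤ sf l x := by
  have h1 : 0 < 1 - z ^ 2 := by nlinarith
  have h2 : 0 < 1 - x ^ 2 := by nlinarith
  have h3 : l ^ 2 ≤ 5 / 2 * (1 - x ^ 2) := by nlinarith
  have d := sf_diff l x z h2.ne' h1.ne'
  have e1 : l ^ 2 * (1 / (1 - z ^ 2)) ≤ 5 / 2 := by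
    rw [mul_one_div, div_le_iff₀ h1]; exact h
  have e2 : l ^ 2 * (1 / (1 - x ^ 2)) ≤ 5 / 2 := by
    rw [mul_one_div, div_le_iff₀ h2]; exact h3
  have e3 : 0 ≤ 5 * l ^ 3 - l ^ 5 * (1 / (1 - x ^ 2) + 1 / (1 - z ^ 2)) := by
    have : 5 * l ^ 3 - l ^ 5 * (1 / (1 - x ^ 2) + 1 / (1 - z ^ 2))
      = l ^ 3 * (5 - l ^ 2 * (1 / (1 - x ^ 2)) - l ^ 2 * (1 / (1 - z ^ 2))) := by ring
    rw [this]
    exact mul_nonneg (by positivity) (by linarith)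
  have : 0 ≤ sf l x - sf l z := by
    rw [d]
    apply mul_nonneg (by linarith)
    apply div_nonneg _ (by norm_num)
    apply mul_nonneg _ e3
    have : 0 ≤ z := by linarith
    positivity
  linarith

lemma sf_mono (l x z : ℝ) (hl : 0 < l) (hx : 0 ≤ x) (hxz : x ≤ z) (hz : z < 1)
    (h : 5 / 2 * (1 - x ^ 2) ≤ l ^ 2) : sf l x ≤ sf l z := by
  have h1 : 0 < 1 - z ^ 2 := by nlinarith
  have h2 : 0 < 1 - x ^ 2 := by nlinarith
  have h3 : 5 / 2 * (1 - z ^ 2) ≤ l ^ 2 := by nlinarith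
  have d := sf_diff l x z h2.ne' h1.ne'
  have e1 : 5 / 2 ≤ l ^ 2 * (1 / (1 - z ^ 2)) := by
    rw [mul_one_div, le_div_iff₀ h1]; exact h3
  have e2 : 5 / 2 ≤ l ^ 2 * (1 / (1 - x ^ 2)) := by
    rw [mul_one_div, le_div_iff₀ h2]; exact h
  have e3 : 0 ≤ -(5 * l ^ 3 - l ^ 5 * (1 / (1 - x ^ 2) + 1 / (1 - z ^ 2))) := by
    have : -(5 * l ^ 3 - l ^ 5 * (1 / (1 - x ^ 2) + 1 / (1 - z ^ 2)))
      = l ^ 3 * (l ^ 2 * (1 / (1 - x ^ 2)) + l ^ 2 * (1 / (1 - z ^ 2)) - 5) := by ring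
    rw [this]
    exact mul_nonneg (by positivity) (by linarith)
  have : 0 ≤ sf l z - sf l x := by
    have d' : sf l z - sf l x = (z - x) * ((1 / (1 - x ^ 2)) * (1 / (1 - z ^ 2)) * (x + z) *
      -(5 * l ^ 3 - l ^ 5 * (1 / (1 - x ^ 2) + 1 / (1 - z ^ 2))) / 2) := by
      linear_combination (-1 : ℝ) * d
    rw [d']
    apply mul_nonneg (by linarith)
    apply div_nonneg _ (by norm_num)
    apply mul_nonneg _ e3
    have : 0 ≤ z := by linarith
    positivity
  linarith

lemma sf_branch (l x : ℝ) (hl : 0 < l) (hx0 : 0 < x) (hx : x < 1) (h : 0 < sf l x) :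
    l ^ 2 < 139 / 100 * (1 - x ^ 2) ∨ 36 / 10 * (1 - x ^ 2) < l ^ 2 := by
  by_contra hc
  push Not at hc
  obtain ⟨h1, h2⟩ := hc
  have hu : 0 < 1 - x ^ 2 := by nlinarith
  have e : sf l x = l / 2 * (1 / (1 - x ^ 2)) ^ 2 *
      (5 * (1 - x ^ 2) ^ 2 - 5 * l ^ 2 * (1 - x ^ 2) + l ^ 4) := by
    unfold sf; field_simp
  rw [e] at h
  have h3 := pos_of_mul_pos_right h (by positivity)
  nlinarith [mul_nonneg (sub_nonneg.2 h1) (sub_nonneg.2 h2), mul_pos hu hu]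

lemma sf_cont (l a b : ℝ) (ha : 0 ≤ a) (hb : b < 1) : ContinuousOn (sf l) (Set.Icc a b) := by
  unfold sf
  have : ∀ x ∈ Set.Icc a b, 1 - x ^ 2 ≠ 0 := by
    rintro x ⟨h1, h2⟩
    have : 0 < 1 - x ^ 2 := by nlinarith
    exact this.ne'
  fun_prop (disch := assumption)

/-- Existence by the intermediate value theorem. -/
lemma exists_sol (l m a b c d : ℝ) (ha : 0 < a) (hab : a ≤ b) (hb : b < 1) (hc : 0 < c)
    (hd : d < 1) (hlb : l ^ 2 ≤ 4 * (1 - b ^ 2)) (hmd : m ^ 2 ≤ 4 * (1 - d ^ 2))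
    (hmap : ∀ x ∈ Set.Icc a b, sf l x ∈ Set.Icc c d)
    (hsgn : (sf m (sf l a) ≤ a ∧ b ≤ sf m (sf l b)) ∨ (a ≤ sf m (sf l a) ∧ sf m (sf l b) ≤ b)) :
    ∃ x y, Sys l m x y ∧ a ≤ x ∧ x ≤ b := by
  have hcont : ContinuousOn (fun x => x - sf m (sf l x)) (Set.Icc a b) := by
    apply continuousOn_id.sub
    exact (sf_cont m c d hc.le hd).comp (sf_cont l a b ha.le hb) hmap
  have : ∃ x ∈ Set.Icc a b, x - sf m (sf l x) = 0 := by
    rcases hsgn with ⟨h1, h2⟩ | ⟨h1, h2⟩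
    · exact intermediate_value_Icc' hab hcont ⟨by simpa using h2, by simpa using h1⟩
    · exact intermediate_value_Icc hab hcont ⟨by simpa using h1, by simpa using h2⟩
  obtain ⟨x, hx, h0⟩ := this
  obtain ⟨hy1, hy2⟩ := hmap x hx
  obtain ⟨hx1, hx2⟩ := hx
  refine ⟨x, sf l x, ⟨by linarith, by linarith, by linarith, by linarith, ?_, ?_, rfl, by linarith⟩,
    hx1, hx2⟩
  · nlinarith
  · nlinarith

lemma pow_bounds (l a b : ℝ) (ha : 0 < a) (h1 : a ≤ l) (h2 : l ≤ b) :
    (a ^ 2 ≤ l ^ 2 ∧ l ^ 2 ≤ b ^ 2) ∧ (a ^ 3 ≤ l ^ 3 ∧ l ^ 3 ≤ b ^ 3) ∧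
      (a ^ 5 ≤ l ^ 5 ∧ l ^ 5 ≤ b ^ 5) := by
  have : 0 < l := by linarith
  refine ⟨⟨?_, ?_⟩, ⟨?_, ?_⟩, ?_, ?_⟩ <;> gcongr

lemma sf_slope (l a b k x z : ℝ) (hl : 0 < l) (ha : 0 ≤ a) (hb : b < 1) (hax : a ≤ x)
    (hxz : x ≤ z) (hzb : z ≤ b)
    (hp : 0 ≤ 5 * l ^ 3 - l ^ 5 * (2 * (1 / (1 - b ^ 2))))
    (hk : k ≤ (1 / (1 - a ^ 2)) * (1 / (1 - a ^ 2)) * (2 * a) *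
      (5 * l ^ 3 - l ^ 5 * (2 * (1 / (1 - b ^ 2)))) / 2) :
    k * (z - x) ≤ sf l x - sf l z := by
  have hx0 : 0 ≤ x := by linarith
  have hz0 : 0 ≤ z := by linarith
  have hua : 0 < 1 - a ^ 2 := by nlinarith
  have hub : 0 < 1 - b ^ 2 := by nlinarith
  have hux : 0 < 1 - x ^ 2 := by nlinarith
  have huz : 0 < 1 - z ^ 2 := by nlinarith
  rw [sf_diff l x z hux.ne' huz.ne', mul_comm]
  apply mul_le_mul_of_nonneg_left _ (by linarith)
  refine hk.trans ?_
  have t1 : 1 / (1 - a ^ 2) ≤ 1 / (1 - x ^ 2) := by gcongr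
  have t2 : 1 / (1 - a ^ 2) ≤ 1 / (1 - z ^ 2) := by gcongr; linarith
  have t3 : 1 / (1 - x ^ 2) ≤ 1 / (1 - b ^ 2) := by gcongr; linarith
  have t4 : 1 / (1 - z ^ 2) ≤ 1 / (1 - b ^ 2) := by gcongr
  have t5 : 1 / (1 - x ^ 2) + 1 / (1 - z ^ 2) ≤ 2 * (1 / (1 - b ^ 2)) := by linarith
  have t6 : 2 * a ≤ x + z := by linarith
  gcongr

lemma sf_le_half (l x : ℝ) (hl : 0 < l) (hu : 0 < 1 - x ^ 2) (h1 : l ^ 2 ≤ 4 * (1 - x ^ 2))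
    (h2 : 36 / 10 * (1 - x ^ 2) < l ^ 2) : sf l x ≤ l / 2 := by
  have e : sf l x = l / 2 * ((5 * (1 - x ^ 2) ^ 2 - 5 * l ^ 2 * (1 - x ^ 2) + l ^ 4) /
      (1 - x ^ 2) ^ 2) := by
    unfold sf; field_simp
  rw [e]
  have : (5 * (1 - x ^ 2) ^ 2 - 5 * l ^ 2 * (1 - x ^ 2) + l ^ 4) / (1 - x ^ 2) ^ 2 ≤ 1 := by
    rw [div_le_one (by positivity)]
    nlinarith [mul_nonneg (sub_nonneg.2 h1) (by linarith : 0 ≤ l ^ 2 - (1 - x ^ 2))]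
  nlinarith

/-- Parameters in the box. -/
structure Box (l m : ℝ) : Prop where
  l1 : 77999 / 100000 ≤ l
  l2 : l ≤ 78001 / 100000
  m1 : 69999 / 100000 ≤ m
  m2 : m ≤ 70001 / 100000

lemma le_of_sq_aux (x c : ℝ) (hc : 0 ≤ c) (h : x ^ 2 ≤ c ^ 2) : x ≤ c := by
  by_contra h'
  push Not at h'
  nlinarith

set_option maxHeartbeats 1000000 in
/-- Every solution is of type A (middle) or type B (right). -/
lemma sol_cases (l m x y : ℝ) (hb : Box l m) (h : Sys l m x y) :
    (2 / 5 ≤ x ∧ x ≤ 58 / 100 ∧ 3 / 5 ≤ y ∧ y ≤ 735 / 1000) ∨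
    (9 / 10 ≤ x ∧ y ≤ 2 / 5) := by
  obtain ⟨l1, l2, m1, m2⟩ := hb
  obtain ⟨hx0, hx1, hy0, hy1, hlx, hmy, hy, hx⟩ := h
  have hl : 0 < l := by linarith
  have hm : 0 < m := by linarith
  obtain ⟨⟨p1, p2⟩, ⟨p3, p4⟩, p5, p6⟩ := pow_bounds l _ _ (by norm_num) l1 l2
  obtain ⟨⟨q1, q2⟩, ⟨q3, q4⟩, q5, q6⟩ := pow_bounds m _ _ (by norm_num) m1 m2
  norm_num at p1 p2 p3 p4 p5 p6 q1 q2 q3 q4 q5 q6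
  have hux : 0 < 1 - x ^ 2 := by nlinarith
  rcases sf_branch l x hl hx0 hx1 (by linarith) with hA | hB
  · left
    have x_hi : x ≤ 752 / 1000 := le_of_sq_aux _ _ (by norm_num) (by linarith)
    have y_hi : y ≤ 806 / 1000 := by
      rcases sf_branch m y hm hy0 hy1 (by linarith) with hC | hD
      · exact le_of_sq_aux _ _ (by norm_num) (by linarith)
      · exfalso
        have h1 : 92 / 100 ≤ y := le_of_sq_aux _ _ hy0.le (by linarith)
        have h2 := sf_anti l 0 x hl le_rfl hx0.le hx1 (by linarith)
        have h3 : sf l 0 ≤ 91 / 100 := by unfold sf; norm_num; linarith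
        linarith
    have hl' : l ^ 2 ≤ 5 / 2 * (1 - x ^ 2) := by linarith
    have hm' : m ^ 2 ≤ 5 / 2 * (1 - y ^ 2) := by
      have : y ^ 2 ≤ (806 / 1000) ^ 2 := by gcongr
      linarith
    have x_lo : 3 / 10 ≤ x := by
      by_contra hc
      push Not at hc
      have h2 := sf_anti l x (3 / 10) hl hx0.le hc.le (by norm_num) (by linarith)
      have h3 : 81 / 100 ≤ sf l (3 / 10) := by unfold sf; norm_num; linarith
      linarith
    have y_lo : 1 / 2 ≤ y := by
      by_contra hc
      push Not at hc
      have h2 := sf_anti m y (1 / 2) hm hy0.le hc.le (by norm_num) (by linarith)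
      have h3 : 755 / 1000 ≤ sf m (1 / 2) := by unfold sf; norm_num; linarith
      linarith
    have x_hi2 : x ≤ 58 / 100 := by
      by_contra hc
      push Not at hc
      have h2 := sf_anti l (58 / 100) x hl (by norm_num) hc.le hx1 hl'
      have h3 : sf l (58 / 100) ≤ 495 / 1000 := by unfold sf; norm_num; linarith
      linarith
    have y_hi2 : y ≤ 735 / 1000 := by
      by_contra hc
      push Not at hc
      have h2 := sf_anti m (735 / 1000) y hm (by norm_num) hc.le hy1 hm'
      have h3 : sf m (735 / 1000) ≤ 295 / 1000 := by unfold sf; norm_num; linarith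
      linarith
    refine ⟨?_, x_hi2, ?_, y_hi2⟩
    · by_contra hc
      push Not at hc
      have h2 := sf_anti l x (2 / 5) hl hx0.le hc.le (by norm_num) (by linarith)
      have h3 : 74 / 100 ≤ sf l (2 / 5) := by unfold sf; norm_num; linarith
      linarith
    · by_contra hc
      push Not at hc
      have h2 := sf_anti m y (3 / 5) hm hy0.le hc.le (by norm_num) (by linarith)
      have h3 : 60 / 100 ≤ sf m (3 / 5) := by unfold sf; norm_num; linarith
      linarith
  · right
    refine ⟨le_of_sq_aux _ _ hx0.le (by linarith), ?_⟩
    have := sf_le_half l x hl hux hlx hB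
    linarith

lemma uniqA (l m x y x' y' : ℝ) (hb : Box l m) (h : Sys l m x y) (h' : Sys l m x' y')
    (hx : x ≤ 58 / 100) (hx' : x' ≤ 58 / 100) (hxx : x ≤ x') : x = x' ∧ y = y' := by
  have c := sol_cases l m x y hb h
  have c' := sol_cases l m x' y' hb h'
  obtain ⟨a1, a2, a3, a4⟩ := c.resolve_right (by rintro ⟨h1, -⟩; linarith)
  obtain ⟨b1, b2, b3, b4⟩ := c'.resolve_right (by rintro ⟨h1, -⟩; linarith)
  obtain ⟨l1, l2, m1, m2⟩ := hb
  have hl : 0 < l := by linarith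
  have hm : 0 < m := by linarith
  obtain ⟨⟨p1, p2⟩, ⟨p3, p4⟩, p5, p6⟩ := pow_bounds l _ _ (by norm_num) l1 l2
  obtain ⟨⟨q1, q2⟩, ⟨q3, q4⟩, q5, q6⟩ := pow_bounds m _ _ (by norm_num) m1 m2
  norm_num at p1 p2 p3 p4 p5 p6 q1 q2 q3 q4 q5 q6
  obtain ⟨-, -, -, -, -, -, ey, ex⟩ := h
  obtain ⟨-, -, -, -, -, -, ey', ex'⟩ := h'
  have s1 := sf_slope l (2 / 5) (58 / 100) (84 / 100) x x' hl (by norm_num) (by norm_num)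
    a1 hxx b2 (by norm_num; linarith) (by norm_num; linarith)
  rw [← ey, ← ey'] at s1
  have hyy : y' ≤ y := by linarith
  have s2 := sf_slope m (3 / 5) (735 / 1000) (14 / 10) y' y hm (by norm_num) (by norm_num)
    b3 hyy a4 (by norm_num; linarith) (by norm_num; linarith)
  rw [← ex, ← ex'] at s2
  have : x = x' := by linarith
  refine ⟨this, ?_⟩
  rw [ey, ey', this]

lemma uniqB (l m x y x' y' : ℝ) (hb : Box l m) (h : Sys l m x y) (h' : Sys l m x' y')
    (hx : 9 / 10 ≤ x) (hx' : 9 / 10 ≤ x') (hxx : x ≤ x') : x = x' ∧ y = y' := by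
  have c := sol_cases l m x y hb h
  have c' := sol_cases l m x' y' hb h'
  obtain ⟨a1, a2⟩ := c.resolve_left (by rintro ⟨-, h1, -⟩; linarith)
  obtain ⟨b1, b2⟩ := c'.resolve_left (by rintro ⟨-, h1, -⟩; linarith)
  obtain ⟨l1, l2, m1, m2⟩ := hb
  have hl : 0 < l := by linarith
  have hm : 0 < m := by linarith
  obtain ⟨hx0, hx1, hy0, hy1, -, -, ey, ex⟩ := h
  obtain ⟨hx0', hx1', hy0', hy1', -, -, ey', ex'⟩ := h'
  have s1 := sf_mono l x x' hl hx0.le hxx hx1' (by nlinarith)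
  rw [← ey, ← ey'] at s1
  have s2 := sf_anti m y y' hm hy0.le s1 hy1' (by nlinarith)
  rw [← ex, ← ex'] at s2
  have : x = x' := by linarith
  refine ⟨this, ?_⟩
  rw [ey, ey', this]

lemma existsA (l m : ℝ) (hb : Box l m) : ∃ x y, Sys l m x y ∧ x ≤ 58 / 100 := by
  obtain ⟨l1, l2, m1, m2⟩ := hb
  have hl : 0 < l := by linarith
  have hm : 0 < m := by linarith
  obtain ⟨⟨p1, p2⟩, ⟨p3, p4⟩, p5, p6⟩ := pow_bounds l _ _ (by norm_num) l1 l2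
  obtain ⟨⟨q1, q2⟩, ⟨q3, q4⟩, q5, q6⟩ := pow_bounds m _ _ (by norm_num) m1 m2
  norm_num at p1 p2 p3 p4 p5 p6 q1 q2 q3 q4 q5 q6
  have f1 : 688 / 1000 ≤ sf l (45 / 100) := by unfold sf; norm_num; linarith
  have f2 : sf l (45 / 100) ≤ 70 / 100 := by unfold sf; norm_num; linarith
  have f3 : 64 / 100 ≤ sf l (48 / 100) := by unfold sf; norm_num; linarith
  have f4 : sf l (48 / 100) ≤ 653 / 1000 := by unfold sf; norm_num; linarith
  have g1 : sf m (688 / 1000) ≤ 45 / 100 := by unfold sf; norm_num; linarith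
  have g2 : 48 / 100 ≤ sf m (653 / 1000) := by unfold sf; norm_num; linarith
  obtain ⟨x, y, h, -, h2⟩ := exists_sol l m (45 / 100) (48 / 100) (64 / 100) (70 / 100)
    (by norm_num) (by norm_num) (by norm_num) (by norm_num) (by norm_num)
    (by linarith) (by linarith)
    (by
      rintro x ⟨h1, h2⟩
      have k1 := sf_anti l (45 / 100) x hl (by norm_num) h1 (by linarith) (by nlinarith)
      have k2 := sf_anti l x (48 / 100) hl (by linarith) h2 (by norm_num) (by linarith)
      exact ⟨by linarith, by linarith⟩)
    (by
      left
      have k1 := sf_anti m (688 / 1000) _ hm (by norm_num) f1 (by linarith) (by nlinarith)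
      have k2 := sf_anti m _ (653 / 1000) hm (by linarith) f4 (by norm_num) (by linarith)
      exact ⟨by linarith, by linarith⟩)
  exact ⟨x, y, h, by linarith⟩

lemma existsB (l m : ℝ) (hb : Box l m) : ∃ x y, Sys l m x y ∧ 9 / 10 ≤ x := by
  obtain ⟨l1, l2, m1, m2⟩ := hb
  have hl : 0 < l := by linarith
  have hm : 0 < m := by linarith
  obtain ⟨⟨p1, p2⟩, ⟨p3, p4⟩, p5, p6⟩ := pow_bounds l _ _ (by norm_num) l1 l2
  obtain ⟨⟨q1, q2⟩, ⟨q3, q4⟩, q5, q6⟩ := pow_bounds m _ _ (by norm_num) m1 m2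
  norm_num at p1 p2 p3 p4 p5 p6 q1 q2 q3 q4 q5 q6
  have f1 : 14 / 100 ≤ sf l (916 / 1000) := by unfold sf; norm_num; linarith
  have f2 : sf l (916 / 1000) ≤ 16 / 100 := by unfold sf; norm_num; linarith
  have f3 : 34 / 100 ≤ sf l (9202 / 10000) := by unfold sf; norm_num; linarith
  have f4 : sf l (9202 / 10000) ≤ 37 / 100 := by unfold sf; norm_num; linarith
  have g1 : 916 / 1000 ≤ sf m (16 / 100) := by unfold sf; norm_num; linarith
  have g2 : sf m (34 / 100) ≤ 9202 / 10000 := by unfold sf; norm_num; linarith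
  obtain ⟨x, y, h, h1, -⟩ := exists_sol l m (916 / 1000) (9202 / 10000) (14 / 100) (37 / 100)
    (by norm_num) (by norm_num) (by norm_num) (by norm_num) (by norm_num)
    (by linarith) (by linarith)
    (by
      rintro x ⟨h1, h2⟩
      have k1 := sf_mono l (916 / 1000) x hl (by norm_num) h1 (by linarith) (by linarith)
      have k2 := sf_mono l x (9202 / 10000) hl (by linarith) h2 (by norm_num) (by nlinarith)
      exact ⟨by linarith, by linarith⟩)
    (by
      right
      have k1 := sf_anti m _ (16 / 100) hm (by linarith) f2 (by norm_num) (by linarith)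
      have k2 := sf_anti m (34 / 100) _ hm (by norm_num) f3 (by linarith) (by nlinarith)
      exact ⟨by linarith, by linarith⟩)
  exact ⟨x, y, h, by linarith⟩

/-- There is a nonempty open set of admissible parameter pairs giving exactly
two isomeric pentagonal Siamese dipyramids. -/
theorem siamese_two_isomeric_open :
    ∃ W : Set (ℝ × ℝ), IsOpen W ∧ W.Nonempty ∧ ∀ q ∈ W,
      (2 * Real.sin (Real.pi / 10) < q.1 ∧ q.1 < 2 * Real.sin (Real.pi / 5)) ∧
      (2 * Real.sin (Real.pi / 10) < q.2 ∧ q.2 < 2 * Real.sin (Real.pi / 5)) ∧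
      {p : ℝ × ℝ | SiamesePosSol5 q.1 q.2 p}.encard = 2 := by
  have hpi1 := Real.pi_gt_d2
  have hpi2 := Real.pi_lt_d2
  have s1 : Real.sin (Real.pi / 10) < 32 / 100 := by
    have := Real.sin_lt (x := Real.pi / 10) (by positivity)
    linarith
  have s2 : 4 / 10 < Real.sin (Real.pi / 5) := by
    have h1 := Real.sin_gt_sub_cube (x := Real.pi / 5) (by positivity)
    have h2 : (Real.pi / 5) ^ 3 ≤ (64 / 100) ^ 3 :=
      pow_le_pow_left₀ (by positivity) (by linarith) 3
    norm_num at h1 h2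
    linarith
  refine ⟨Set.Ioo (77999 / 100000) (78001 / 100000) ×ˢ Set.Ioo (69999 / 100000) (70001 / 100000),
    isOpen_Ioo.prod isOpen_Ioo, ⟨(78 / 100, 70 / 100), ?_⟩, ?_⟩
  · constructor <;> constructor <;> norm_num
  · rintro ⟨l, m⟩ ⟨⟨l1, l2⟩, ⟨m1, m2⟩⟩
    dsimp only at l1 l2 m1 m2 ⊢
    refine ⟨⟨by linarith, by linarith⟩, ⟨by linarith, by linarith⟩, ?_⟩
    have hb : Box l m := ⟨l1.le, l2.le, m1.le, m2.le⟩
    obtain ⟨xA, yA, hA, hxA⟩ := existsA l m hb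
    obtain ⟨xB, yB, hB, hxB⟩ := existsB l m hb
    rw [Set.encard_eq_two]
    refine ⟨(xA, yA), (xB, yB), ?_, ?_⟩
    · intro h
      have : xA = xB := congrArg Prod.fst h
      linarith
    · ext ⟨x, y⟩
      simp only [Set.mem_ofPred_eq, Set.mem_insert_iff, Set.mem_singleton_iff]
      rw [sol_iff l m (by linarith) (by linarith)]
      constructor
      · intro h
        dsimp only at h
        rcases sol_cases l m x y hb h with ⟨-, hx, -⟩ | ⟨hx, -⟩
        · left
          rcases le_total x xA with hh | hh
          · obtain ⟨e1, e2⟩ := uniqA l m x y xA yA hb h hA hx hxA hh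
            rw [e1, e2]
          · obtain ⟨e1, e2⟩ := uniqA l m xA yA x y hb hA h hxA hx hh
            rw [e1, e2]
        · right
          rcases le_total x xB with hh | hh
          · obtain ⟨e1, e2⟩ := uniqB l m x y xB yB hb h hB hx hxB hh
            rw [e1, e2]
          · obtain ⟨e1, e2⟩ := uniqB l m xB yB x y hb hB h hxB hx hh
            rw [e1, e2]
      · rintro (h | h)
        · rw [h]; exact hA
        · rw [h]; exact hB
end
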